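/- arXiv:math/0108104 — 5 statements merged into one kernel-verified Lean document; each statement's English description precedes it below -/
import Mathlib

section
/- Let S be a commutative ℂ-algebra. (a) For every ℂ-linear derivation D : S → S, the set A_D := {p ∈ S[t] : coeff 1 p = D (coeff 0 p)} is a ℂ-subalgebra of S[t] = Polynomial S which satisfies: (1) t²·p ∈ A_D for every p ∈ S[t]; (2) for every s ∈ S there exists p ∈ A_D with coeff 0 p = s; (3) every p ∈ A_D with coeff 0 p = 0 has coeff 1 p = 0. (b) Conversely, if A is any ℂ-subalgebra of S[t] satisfying conditions (1), (2), (3), then there is a unique ℂ-linear derivation D : S → S such that A = {p ∈ S[t] : coeff 1 p = D (coeff 0 p)}. -/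
open Polynomial

/-- The subalgebra of polynomials whose linear coefficient is the image under the derivation `D`
of their constant coefficient. -/
def cuspSubalgebra {R S : Type*} [CommSemiring R] [CommSemiring S] [Algebra R S]
    (D : Derivation R S S) : Subalgebra R S[X] where
  carrier := {p | p.coeff 1 = D (p.coeff 0)}
  mul_mem' {p q} hp hq := by
    simp only [Set.mem_ofPred_eq] at hp hq ⊢
    rw [mul_coeff_one, mul_coeff_zero, D.leibniz, hp, hq, smul_eq_mul, smul_eq_mul,
      mul_comm (D (p.coeff 0))]
  add_mem' {p q} hp hq := by
    simp only [Set.mem_ofPred_eq] at hp hq ⊢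
    rw [coeff_add, coeff_add, map_add, hp, hq]
  algebraMap_mem' r := by
    simp [Polynomial.algebraMap_apply, coeff_C]

@[simp]
theorem mem_cuspSubalgebra {R S : Type*} [CommSemiring R] [CommSemiring S] [Algebra R S]
    {D : Derivation R S S} {p : S[X]} : p ∈ cuspSubalgebra D ↔ p.coeff 1 = D (p.coeff 0) :=
  Iff.rfl

theorem exists_derivation_eq_cuspSubalgebra {R S : Type*} [CommRing R] [CommRing S] [Algebra R S]
    (A : Subalgebra R S[X]) (hX : ∀ p : S[X], X ^ 2 * p ∈ A)
    (hsurj : ∀ s : S, ∃ p ∈ A, p.coeff 0 = s)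
    (hzero : ∀ p ∈ A, p.coeff 0 = 0 → p.coeff 1 = 0) :
    ∃ D : Derivation R S S, A = cuspSubalgebra D := by
  choose f hfA hf using hsurj
  have coeff_one_eq {p : S[X]} (hp : p ∈ A) : p.coeff 1 = (f (p.coeff 0)).coeff 1 := by
    have h := hzero _ (sub_mem hp (hfA (p.coeff 0))) (by simp [hf])
    rwa [coeff_sub, sub_eq_zero] at h
  let L : S →ₗ[R] S :=
    { toFun s := (f s).coeff 1
      map_add' s t := by
        simpa [hf] using (coeff_one_eq (add_mem (hfA s) (hfA t))).symm
      map_smul' r s := by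
        simpa [hf] using (coeff_one_eq (A.smul_mem (hfA s) r)).symm }
  refine ⟨Derivation.mk' L fun s t => ?_, ?_⟩
  · have h := coeff_one_eq (mul_mem (hfA s) (hfA t))
    rw [mul_coeff_one, mul_coeff_zero, hf, hf] at h
    change (f (s * t)).coeff 1 = s * (f t).coeff 1 + t * (f s).coeff 1
    rw [← h, mul_comm t]
  · ext p
    refine ⟨coeff_one_eq, fun hp => ?_⟩
    replace hp : p.coeff 1 = (f (p.coeff 0)).coeff 1 := hp
    obtain ⟨q, hq⟩ : X ^ 2 ∣ p - f (p.coeff 0) := by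
      rw [X_pow_dvd_iff]
      intro d hd
      interval_cases d
      · simp [hf]
      · simp [hp]
    rw [← sub_add_cancel p (f (p.coeff 0)), hq]
    exact add_mem (hX q) (hfA _)

theorem exists_mem_cuspSubalgebra_coeff_zero_eq {R S : Type*} [CommSemiring R] [CommSemiring S]
    [Algebra R S] (D : Derivation R S S) (s : S) : ∃ p ∈ cuspSubalgebra D, p.coeff 0 = s :=
  ⟨C s + C (D s) * X, by simp [coeff_C], by simp⟩

theorem cuspSubalgebra_injective {R S : Type*} [CommSemiring R] [CommSemiring S] [Algebra R S] :
    Function.Injective (cuspSubalgebra : Derivation R S S → Subalgebra R S[X]) := by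
  intro D E h
  ext s
  obtain ⟨p, hp, rfl⟩ := exists_mem_cuspSubalgebra_coeff_zero_eq D s
  have hE : p ∈ cuspSubalgebra E := h ▸ hp
  exact (mem_cuspSubalgebra.1 hp).symm.trans (mem_cuspSubalgebra.1 hE)

/-- (a) For every `ℂ`-linear derivation `D : S → S`, the set
`A_D = {p ∈ S[t] : coeff 1 p = D (coeff 0 p)}` is a `ℂ`-subalgebra of `S[t]` satisfying:
(1) `t²·p ∈ A_D` for every `p`; (2) every `s ∈ S` is the constant term of some element of `A_D`;
(3) every element of `A_D` with vanishing constant term has vanishing linear term.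
(b) Conversely, every `ℂ`-subalgebra of `S[t]` satisfying (1), (2), (3) is of the form `A_D`
for a unique `ℂ`-linear derivation `D`. -/
theorem cusp_descent_subalgebra_iff_derivation (S : Type*) [CommRing S] [Algebra ℂ S] :
    (∀ D : Derivation ℂ S S,
      ∃ A : Subalgebra ℂ (Polynomial S),
        (A : Set (Polynomial S)) = {p | p.coeff 1 = D (p.coeff 0)} ∧
        (∀ p : Polynomial S, X ^ 2 * p ∈ A) ∧
        (∀ s : S, ∃ p ∈ A, p.coeff 0 = s) ∧
        (∀ p ∈ A, p.coeff 0 = 0 → p.coeff 1 = 0)) ∧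
    (∀ A : Subalgebra ℂ (Polynomial S),
      (∀ p : Polynomial S, X ^ 2 * p ∈ A) →
      (∀ s : S, ∃ p ∈ A, p.coeff 0 = s) →
      (∀ p ∈ A, p.coeff 0 = 0 → p.coeff 1 = 0) →
      ∃! D : Derivation ℂ S S,
        (A : Set (Polynomial S)) = {p | p.coeff 1 = D (p.coeff 0)}) := by
  refine ⟨fun D => ⟨cuspSubalgebra D, rfl, fun p => ?_,
    exists_mem_cuspSubalgebra_coeff_zero_eq D, fun p hp h0 => ?_⟩, fun A hX hsurj hzero => ?_⟩
  · simp [coeff_X_pow_mul']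
  · rw [mem_cuspSubalgebra.1 hp, h0, map_zero]
  · obtain ⟨D, rfl⟩ := exists_derivation_eq_cuspSubalgebra A hX hsurj hzero
    exact ⟨D, rfl, fun E hE => cuspSubalgebra_injective (SetLike.coe_injective hE.symm)⟩
end

section
/- Let S be a commutative ℂ-algebra, D : S → S a ℂ-linear derivation, and A_D := {p ∈ S[t] : coeff 1 p = D (coeff 0 p)} ⊆ Polynomial S. Let h : S → ℂ[t] be a ℂ-algebra homomorphism, and let h̄ : Polynomial S → Polynomial ℂ be the ring homomorphism sending ∑ sᵢ tⁱ to ∑ h(sᵢ) tⁱ (i.e. h̄ p = eval₂ h X p). Then h̄ maps A_D into R := {f ∈ ℂ[t] : coeff 1 f = 0} if and only if for every s ∈ S one has coeff 1 (h s) = − coeff 0 (h (D s)). -/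
open Polynomial

theorem Polynomial.coeff_zero_eval₂_X {S R : Type*} [Semiring S] [CommSemiring R]
    (f : S →+* R[X]) (p : S[X]) :
    (p.eval₂ f X).coeff 0 = (f (p.coeff 0)).coeff 0 := by
  conv_lhs => rw [← divX_mul_X_add p]
  simp [eval₂_add]

theorem Polynomial.coeff_one_eval₂_X {S R : Type*} [Semiring S] [CommSemiring R]
    (f : S →+* R[X]) (p : S[X]) :
    (p.eval₂ f X).coeff 1 = (f (p.coeff 0)).coeff 1 + (f (p.coeff 1)).coeff 0 := by
  conv_lhs => rw [← divX_mul_X_add p]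
  rw [eval₂_add, eval₂_mul_X, eval₂_C, coeff_add, coeff_mul_X, coeff_zero_eval₂_X,
    coeff_divX, add_comm]

/-- Let `D : S → S` be a `ℂ`-linear derivation, `A_D = {p ∈ S[t] : coeff 1 p = D (coeff 0 p)}`,
and let `h : S → ℂ[t]` be a `ℂ`-algebra homomorphism, inducing
`h̄ : S[t] → ℂ[t]`, `∑ sᵢ tⁱ ↦ ∑ h(sᵢ) tⁱ`.  Then `h̄` maps `A_D` into
`R = {f ∈ ℂ[t] : coeff 1 f = 0}` if and only if
`coeff 1 (h s) = − coeff 0 (h (D s))` for every `s ∈ S`. -/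
theorem cusp_section_iff_derivative_condition (S : Type*) [CommRing S] [Algebra ℂ S]
    (D : Derivation ℂ S S) (h : S →ₐ[ℂ] Polynomial ℂ) :
    (∀ p ∈ {p : Polynomial S | p.coeff 1 = D (p.coeff 0)},
        (Polynomial.eval₂ (h : S →+* Polynomial ℂ) X p).coeff 1 = 0)
      ↔ ∀ s : S, (h s).coeff 1 = - (h (D s)).coeff 0 := by
  simp only [Set.mem_ofPred_eq, coeff_one_eval₂_X, AlgHom.coe_toRingHom, eq_neg_iff_add_eq_zero]
  constructor
  · intro H s
    have h₀ : (C s + C (D s) * X).coeff 0 = s := by simp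
    have h₁ : (C s + C (D s) * X).coeff 1 = D s := by simp
    have key := H (C s + C (D s) * X) (by rw [h₀, h₁])
    rwa [h₀, h₁] at key
  · intro H p hp
    rw [hp]
    exact H _
end

section
/- Let S be a commutative ℂ-algebra. (a) For every ℂ-algebra automorphism φ : S ≃ S, the set A_φ := {(p,q) ∈ S[t] × S[t] : coeff 0 p = φ (coeff 0 q)} is a ℂ-subalgebra of S[t] × S[t] which satisfies: (1) (t·p, t·q) ∈ A_φ for all p, q ∈ S[t]; (2) for every s ∈ S there exists (p,q) ∈ A_φ with coeff 0 q = s; (2′) for every s ∈ S there exists (p,q) ∈ A_φ with coeff 0 p = s; (3) every (p,q) ∈ A_φ with coeff 0 q = 0 has coeff 0 p = 0; (3′) every (p,q) ∈ A_φ with coeff 0 p = 0 has coeff 0 q = 0. (b) Conversely, if A is any ℂ-subalgebra of S[t] × S[t] satisfying conditions (1), (2), (2′), (3), (3′), then there is a unique ℂ-algebra automorphism φ : S ≃ S such that A = {(p,q) : coeff 0 p = φ (coeff 0 q)}. -/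
open Polynomial

/-- Two surjective algebra homomorphisms with the same kernel differ by an isomorphism of their
targets. -/
theorem AlgHom.exists_algEquiv_of_ker_eq {R B S T : Type*} [CommRing R] [CommRing B] [CommRing S]
    [CommRing T] [Algebra R B] [Algebra R S] [Algebra R T] {f : B →ₐ[R] T} {g : B →ₐ[R] S}
    (hf : Function.Surjective f) (hg : Function.Surjective g)
    (h : RingHom.ker g = RingHom.ker f) : ∃ φ : S ≃ₐ[R] T, ∀ b, f b = φ (g b) := by
  refine ⟨(Ideal.quotientKerAlgEquivOfSurjective hg).symm.trans
    ((Ideal.quotientEquivAlgOfEq R h).trans (Ideal.quotientKerAlgEquivOfSurjective hf)),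
    fun b => ?_⟩
  have hb : (Ideal.quotientKerAlgEquivOfSurjective hg).symm (g b) = Ideal.Quotient.mk _ b := by
    rw [AlgEquiv.symm_apply_eq]
    rfl
  rw [AlgEquiv.trans_apply, hb]
  rfl

/-- (a) For every `ℂ`-algebra automorphism `φ : S ≃ S`, the set
`A_φ = {(p,q) ∈ S[t] × S[t] : coeff 0 p = φ (coeff 0 q)}` is a `ℂ`-subalgebra of
`S[t] × S[t]` satisfying conditions (1), (2), (2′), (3), (3′).
(b) Conversely, every `ℂ`-subalgebra of `S[t] × S[t]` satisfying (1), (2), (2′), (3), (3′)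
is of the form `A_φ` for a unique `ℂ`-algebra automorphism `φ`. -/
theorem node_descent_subalgebra_iff_automorphism (S : Type*) [CommRing S] [Algebra ℂ S] :
    (∀ φ : S ≃ₐ[ℂ] S,
      ∃ A : Subalgebra ℂ (Polynomial S × Polynomial S),
        (A : Set (Polynomial S × Polynomial S)) = {pq | pq.1.coeff 0 = φ (pq.2.coeff 0)} ∧
        (∀ p q : Polynomial S, (X * p, X * q) ∈ A) ∧
        (∀ s : S, ∃ pq ∈ A, pq.2.coeff 0 = s) ∧
        (∀ s : S, ∃ pq ∈ A, pq.1.coeff 0 = s) ∧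
        (∀ pq ∈ A, pq.2.coeff 0 = 0 → pq.1.coeff 0 = 0) ∧
        (∀ pq ∈ A, pq.1.coeff 0 = 0 → pq.2.coeff 0 = 0)) ∧
    (∀ A : Subalgebra ℂ (Polynomial S × Polynomial S),
      (∀ p q : Polynomial S, (X * p, X * q) ∈ A) →
      (∀ s : S, ∃ pq ∈ A, pq.2.coeff 0 = s) →
      (∀ s : S, ∃ pq ∈ A, pq.1.coeff 0 = s) →
      (∀ pq ∈ A, pq.2.coeff 0 = 0 → pq.1.coeff 0 = 0) →
      (∀ pq ∈ A, pq.1.coeff 0 = 0 → pq.2.coeff 0 = 0) →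
      ∃! φ : S ≃ₐ[ℂ] S,
        (A : Set (Polynomial S × Polynomial S)) = {pq | pq.1.coeff 0 = φ (pq.2.coeff 0)}) := by
  let e : S[X] →ₐ[ℂ] S := (aeval (0 : S)).restrictScalars ℂ
  have he (p : S[X]) : e p = p.coeff 0 := (coeff_zero_eq_aeval_zero p).symm
  refine ⟨fun φ => ?_, fun A h1 h2 h2' h3 h3' => ?_⟩
  · let A : Subalgebra ℂ (S[X] × S[X]) :=
      AlgHom.equalizer (e.comp (AlgHom.fst ℂ _ _)) ((φ : S →ₐ[ℂ] S).comp (e.comp (AlgHom.snd ℂ _ _)))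
    have hA (pq : S[X] × S[X]) : pq ∈ A ↔ pq.1.coeff 0 = φ (pq.2.coeff 0) := by
      rw [← he, ← he]
      rfl
    refine ⟨A, Set.ext hA, fun p q => ?_, fun s => ⟨(C (φ s), C s), ?_, ?_⟩,
      fun s => ⟨(C s, C (φ.symm s)), ?_, ?_⟩, fun pq h h0 => ?_, fun pq h h0 => ?_⟩
    any_goals simp [hA]
    · rw [(hA pq).1 h, h0, map_zero]
    · rwa [hA, h0, eq_comm, map_eq_zero_iff φ φ.injective] at h
  · let f : A →ₐ[ℂ] S := (e.comp (AlgHom.fst ℂ _ _)).comp A.val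
    let g : A →ₐ[ℂ] S := (e.comp (AlgHom.snd ℂ _ _)).comp A.val
    have hf_apply (a : A) : f a = a.1.1.coeff 0 := he _
    have hg_apply (a : A) : g a = a.1.2.coeff 0 := he _
    have hf : Function.Surjective f := fun s => by
      obtain ⟨pq, hpq, hs⟩ := h2' s
      exact ⟨⟨pq, hpq⟩, (hf_apply _).trans hs⟩
    have hg : Function.Surjective g := fun s => by
      obtain ⟨pq, hpq, hs⟩ := h2 s
      exact ⟨⟨pq, hpq⟩, (hg_apply _).trans hs⟩
    have hker : RingHom.ker g = RingHom.ker f := by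
      ext a
      rw [RingHom.mem_ker, RingHom.mem_ker, hf_apply, hg_apply]
      exact ⟨h3 a a.2, h3' a a.2⟩
    obtain ⟨φ, hφ⟩ := AlgHom.exists_algEquiv_of_ker_eq hf hg hker
    have hφA (pq : S[X] × S[X]) (h : pq ∈ A) : pq.1.coeff 0 = φ (pq.2.coeff 0) := by
      simpa only [hf_apply, hg_apply] using hφ ⟨pq, h⟩
    refine ⟨φ, Set.ext fun pq => ⟨hφA pq, fun h => ?_⟩, fun ψ hψ => ?_⟩
    · obtain ⟨b, hb, hbq⟩ := h2 (pq.2.coeff 0)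
      have hbp : b.1.coeff 0 = pq.1.coeff 0 := by
        rw [hφA b hb, hbq]
        exact h.symm
      have hdiff : pq - b ∈ A := by
        obtain ⟨u, hu⟩ := X_dvd_iff.2 (show (pq.1 - b.1).coeff 0 = 0 by simp [hbp])
        obtain ⟨v, hv⟩ := X_dvd_iff.2 (show (pq.2 - b.2).coeff 0 = 0 by simp [hbq])
        have : pq - b = (X * u, X * v) := Prod.ext hu hv
        exact this ▸ h1 u v
      exact sub_add_cancel pq b ▸ add_mem hdiff hb
    · ext s
      obtain ⟨b, hb, rfl⟩ := h2 s
      have hb' : b.1.coeff 0 = ψ (b.2.coeff 0) := hψ.subset hb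
      rw [← hb', hφA b hb]
end

section
/- Let r ≥ 1 and let f : (Fin r → ℂ) → (Fin r → ℂ) be a polynomial map, i.e. there are multivariable polynomials P i ∈ MvPolynomial (Fin r) ℂ with f x i = eval x (P i) for all x and i. Assume: (1) there is a group action α of the units ℂˣ on Fin r → ℂ (α 1 = id and α (s·t) = α s ∘ α t) which is algebraic in the sense that there exist N ∈ ℕ and polynomials Q i ∈ MvPolynomial (Fin (r+1)) ℂ such that for every t ∈ ℂˣ, every x and every i, tᴺ · (α t x i) = eval (Fin.cons (t:ℂ) x) (Q i); (2) there are strictly positive integers w i such that for every t ∈ ℂˣ and every x, f (α t x) i = t^(−(w i)) · (f x i) (i.e. f is equivariant for a linear ℂˣ-action on the target with strictly negative weights); (3) for every x ∈ Fin r → ℂ, the Jacobian matrix with entries eval x (pderiv j (P i)) is invertible. Then f is bijective. -/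
open MvPolynomial

noncomputable section

namespace PolyForm

variable {σ K : Type*} [Field K]

lemma commutator_eq (D₁ D₂ : Derivation K (MvPolynomial σ K) (MvPolynomial σ K))
    (a : MvPolynomial σ K) : ⁅D₁, D₂⁆ a = D₁ (D₂ a) - D₂ (D₁ a) :=
  Derivation.commutator_apply a

lemma pderiv_pderiv_comm (i j : σ) (a : MvPolynomial σ K) :
    pderiv i (pderiv j a) = pderiv j (pderiv i a) := by
  have h : ⁅pderiv i, pderiv j⁆ = (0 : Derivation K (MvPolynomial σ K) (MvPolynomial σ K)) :=
    MvPolynomial.derivation_ext fun k => by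
      classical
      rw [commutator_eq, pderiv_X, pderiv_X, Pi.single_apply, Pi.single_apply]
      split_ifs <;> simp
  rw [← sub_eq_zero, ← commutator_eq, h, Derivation.zero_apply]

/-- Algebraic differential forms on the affine space with coordinates `σ`: a form is the family of
its coefficients with respect to the monomials `dx_S`, `S ⊆ σ`. -/
abbrev Form (σ K : Type*) [Field K] : Type _ := Finset σ → MvPolynomial σ K

/-- Multiplication by a function. -/
def mulFun (a : MvPolynomial σ K) : Module.End K (Form σ K) where
  toFun ω S := a * ω S
  map_add' ω η := by ext1 S; simp [mul_add]
  map_smul' c ω := by ext1 S; simp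

/-- Coefficientwise partial derivative. -/
def partialD (j : σ) : Module.End K (Form σ K) where
  toFun ω S := pderiv j (ω S)
  map_add' ω η := by ext1 S; simp
  map_smul' c ω := by ext1 S; simp

@[simp] lemma mulFun_apply (a : MvPolynomial σ K) (ω : Form σ K) (S : Finset σ) :
    mulFun a ω S = a * ω S := rfl

@[simp] lemma partialD_apply (j : σ) (ω : Form σ K) (S : Finset σ) :
    partialD j ω S = pderiv j (ω S) := rfl

lemma partialD_mul_partialD (i j : σ) :
    (partialD i * partialD j : Module.End K (Form σ K)) = partialD j * partialD i := by
  refine LinearMap.ext fun ω => funext fun S => ?_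
  exact pderiv_pderiv_comm i j (ω S)

lemma partialD_mul_mulFun (j : σ) (a : MvPolynomial σ K) :
    partialD j * mulFun a = mulFun a * partialD j + mulFun (pderiv j a) := by
  refine LinearMap.ext fun ω => funext fun S => ?_
  simp [Derivation.leibniz, mul_comm]

lemma mulFun_mul (a b : MvPolynomial σ K) : mulFun (a * b) = mulFun a * mulFun b := by
  refine LinearMap.ext fun ω => funext fun S => ?_
  simp [mul_assoc]

lemma mulFun_sum {ι : Type*} (s : Finset ι) (a : ι → MvPolynomial σ K) :
    mulFun (∑ i ∈ s, a i) = ∑ i ∈ s, mulFun (a i) := by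
  refine LinearMap.ext fun ω => funext fun S => ?_
  simp [Finset.sum_mul]

lemma mulFun_one : (mulFun 1 : Module.End K (Form σ K)) = 1 := by
  refine LinearMap.ext fun ω => funext fun S => ?_
  simp

lemma mulFun_comm (a b : MvPolynomial σ K) : mulFun a * mulFun b = mulFun b * mulFun a := by
  rw [← mulFun_mul, ← mulFun_mul, mul_comm]

variable [LinearOrder σ]

/-- The sign of moving `dx_j` into its place among the `dx_i`, `i ∈ S`. -/
def sgn (j : σ) (S : Finset σ) : ℤ := ∏ i ∈ S, if i < j then -1 else 1

/-- Exterior multiplication by `dx_j` from the left. -/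
def wedge (j : σ) : Module.End K (Form σ K) where
  toFun ω S := if j ∈ S then sgn j S • ω (S.erase j) else 0
  map_add' ω η := by ext1 S; simp only [Pi.add_apply]; split_ifs <;> simp
  map_smul' c ω := by ext1 S; simp only [Pi.smul_apply]; split_ifs <;> simp [smul_comm]

/-- Contraction with the coordinate vector field `∂/∂x_j`. -/
def contract (j : σ) : Module.End K (Form σ K) where
  toFun ω S := if j ∈ S then 0 else sgn j S • ω (insert j S)
  map_add' ω η := by ext1 S; simp only [Pi.add_apply]; split_ifs <;> simp
  map_smul' c ω := by ext1 S; simp only [Pi.smul_apply]; split_ifs <;> simp [smul_comm]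

lemma sgn_mul_self (j : σ) (S : Finset σ) : sgn j S * sgn j S = 1 := by
  rw [sgn, ← Finset.prod_mul_distrib]
  exact Finset.prod_eq_one fun i _ => by split_ifs <;> simp

lemma sgn_insert (j : σ) {i : σ} {S : Finset σ} (h : i ∉ S) :
    sgn j (insert i S) = (if i < j then -1 else 1) * sgn j S := Finset.prod_insert h

lemma sgn_eq_erase (j : σ) {i : σ} {S : Finset σ} (h : i ∈ S) :
    sgn j S = (if i < j then -1 else 1) * sgn j (S.erase i) :=
  (Finset.mul_prod_erase S _ h).symm

lemma wedge_mul_wedge_add (i j : σ) :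
    (wedge i * wedge j + wedge j * wedge i : Module.End K (Form σ K)) = 0 := by
  refine LinearMap.ext fun ω => funext fun S => ?_
  simp only [Module.End.mul_apply, LinearMap.add_apply, Pi.add_apply, wedge, LinearMap.coe_mk,
    AddHom.coe_mk, Finset.mem_erase, LinearMap.zero_apply, Pi.zero_apply]
  rcases eq_or_ne i j with rfl | hij
  · simp
  by_cases hi : i ∈ S <;> by_cases hj : j ∈ S <;> simp only [hi, hj, hij, hij.symm, ne_eq,
    not_false_eq_true, and_self, and_false, if_true, if_false, smul_zero, add_zero]
  rw [Finset.erase_right_comm, smul_smul, smul_smul, ← add_smul, sgn_eq_erase i hj,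
    sgn_eq_erase j hi]
  rcases hij.lt_or_gt with h | h <;> simp [h, h.not_gt, mul_comm]

lemma contract_mul_contract_add (i j : σ) :
    (contract i * contract j + contract j * contract i : Module.End K (Form σ K)) = 0 := by
  refine LinearMap.ext fun ω => funext fun S => ?_
  simp only [Module.End.mul_apply, LinearMap.add_apply, Pi.add_apply, contract, LinearMap.coe_mk,
    AddHom.coe_mk, Finset.mem_insert, LinearMap.zero_apply, Pi.zero_apply]
  rcases eq_or_ne i j with rfl | hij
  · simp
  by_cases hi : i ∈ S <;> by_cases hj : j ∈ S <;> simp only [hi, hj, hij, hij.symm, or_true,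
    or_self, if_true, if_false, smul_zero, add_zero]
  rw [Finset.insert_comm, smul_smul, smul_smul, ← add_smul, sgn_insert i hj, sgn_insert j hi]
  rcases hij.lt_or_gt with h | h <;> simp [h, h.not_gt, mul_comm]

lemma contract_mul_wedge_add (i j : σ) :
    (contract i * wedge j + wedge j * contract i : Module.End K (Form σ K)) =
      if i = j then 1 else 0 := by
  refine LinearMap.ext fun ω => funext fun S => ?_
  simp only [LinearMap.add_apply, Pi.add_apply, Module.End.mul_apply, wedge, contract,
    LinearMap.coe_mk, AddHom.coe_mk, Finset.mem_insert, Finset.mem_erase]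
  rcases eq_or_ne i j with rfl | hij
  · by_cases hi : i ∈ S
    · simp [hi, -zsmul_eq_mul, smul_smul, sgn_eq_erase i hi, sgn_mul_self]
    · simp [hi, -zsmul_eq_mul, smul_smul, sgn_insert i hi, sgn_mul_self]
  by_cases hi : i ∈ S <;> by_cases hj : j ∈ S <;> simp only [hi, hj, hij, hij.symm, or_true,
    or_self, if_true, if_false, smul_zero, ne_eq, not_false_eq_true, and_self, and_false,
    LinearMap.zero_apply, Pi.zero_apply, add_zero]
  have hie : i ∉ S.erase j := by simp [hi]
  rw [Finset.erase_insert_of_ne hij, smul_smul, smul_smul, ← add_smul, sgn_insert j hi,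
    sgn_eq_erase i hj]
  rcases hij.lt_or_gt with h | h <;> simp [h, h.not_gt, mul_comm]

lemma wedge_mul_mulFun (j : σ) (a : MvPolynomial σ K) :
    wedge j * mulFun a = mulFun a * wedge j := by
  refine LinearMap.ext fun ω => funext fun S => ?_
  simp only [Module.End.mul_apply, wedge, LinearMap.coe_mk, AddHom.coe_mk, mulFun_apply]
  split_ifs <;> simp [mul_left_comm]

lemma contract_mul_mulFun (j : σ) (a : MvPolynomial σ K) :
    contract j * mulFun a = mulFun a * contract j := by
  refine LinearMap.ext fun ω => funext fun S => ?_
  simp only [Module.End.mul_apply, contract, LinearMap.coe_mk, AddHom.coe_mk, mulFun_apply]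
  split_ifs <;> simp [mul_left_comm]

lemma partialD_mul_wedge (i j : σ) :
    (partialD i * wedge j : Module.End K (Form σ K)) = wedge j * partialD i := by
  refine LinearMap.ext fun ω => funext fun S => ?_
  simp only [Module.End.mul_apply, wedge, LinearMap.coe_mk, AddHom.coe_mk, partialD_apply]
  split_ifs <;> simp

lemma partialD_mul_contract (i j : σ) :
    (partialD i * contract j : Module.End K (Form σ K)) = contract j * partialD i := by
  refine LinearMap.ext fun ω => funext fun S => ?_
  simp only [Module.End.mul_apply, contract, LinearMap.coe_mk, AddHom.coe_mk, partialD_apply]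
  split_ifs <;> simp

variable [Fintype σ]

/-- The exterior derivative. -/
def extD : Module.End K (Form σ K) := ∑ j, wedge j * partialD j

/-- Contraction with the vector field `∑ v_j ∂/∂x_j`. -/
def interior (v : σ → MvPolynomial σ K) : Module.End K (Form σ K) :=
  ∑ j, mulFun (v j) * contract j

/-- Exterior multiplication by the one-form `∑ g_j dx_j`. -/
def wedgeOne (g : σ → MvPolynomial σ K) : Module.End K (Form σ K) :=
  ∑ j, mulFun (g j) * wedge j

omit [LinearOrder σ] in
lemma sum_sum_eq_zero_of_antisymm [CharZero K] {M : Type*} [AddCommGroup M]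
    [Module K M] (F : σ → σ → M)
    (h : ∀ i j, F i j + F j i = 0) : ∑ i, ∑ j, F i j = 0 := by
  have h2 : (2 : K) • ∑ i, ∑ j, F i j = 0 := by
    rw [two_smul]
    nth_rewrite 1 [Finset.sum_comm]
    simp_rw [← Finset.sum_add_distrib]
    exact Finset.sum_eq_zero fun i _ => Finset.sum_eq_zero fun j _ => h j i
  simpa using h2

variable [CharZero K]

lemma extD_mul_extD : (extD * extD : Module.End K (Form σ K)) = 0 := by
  rw [extD, Finset.sum_mul_sum]
  refine sum_sum_eq_zero_of_antisymm (K := K) _ fun i j => ?_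
  have h : ∀ i j : σ, (wedge i * partialD i * (wedge j * partialD j) : Module.End K (Form σ K)) =
      wedge i * wedge j * (partialD i * partialD j) := fun i j => by
    rw [mul_assoc, ← mul_assoc (partialD i), partialD_mul_wedge]
    simp only [mul_assoc]
  rw [h, h, partialD_mul_partialD j i, ← add_mul, wedge_mul_wedge_add, zero_mul]

lemma interior_mul_interior (v : σ → MvPolynomial σ K) : interior v * interior v = 0 := by
  rw [interior, Finset.sum_mul_sum]
  refine sum_sum_eq_zero_of_antisymm (K := K) _ fun i j => ?_
  have h : ∀ i j : σ, mulFun (v i) * contract i * (mulFun (v j) * contract j) =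
      mulFun (v i) * mulFun (v j) * (contract i * contract j) := fun i j => by
    rw [mul_assoc, ← mul_assoc (contract i), contract_mul_mulFun]
    simp only [mul_assoc]
  rw [h, h, mulFun_comm (v j), ← mul_add, contract_mul_contract_add, mul_zero]

omit [CharZero K]

lemma interior_mul_mulFun (v : σ → MvPolynomial σ K) (a : MvPolynomial σ K) :
    interior v * mulFun a = mulFun a * interior v := by
  simp_rw [interior, Finset.sum_mul, Finset.mul_sum, mul_assoc, contract_mul_mulFun,
    ← mul_assoc, mulFun_comm a]

/-- The commutator of the exterior derivative with a function is exterior multiplication by its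
differential. -/
lemma extD_mul_mulFun (a : MvPolynomial σ K) :
    extD * mulFun a = mulFun a * extD + wedgeOne fun j => pderiv j a := by
  simp_rw [extD, wedgeOne, Finset.sum_mul, Finset.mul_sum, ← Finset.sum_add_distrib, mul_assoc,
    partialD_mul_mulFun, mul_add, wedge_mul_mulFun, ← mul_assoc, wedge_mul_mulFun]

/-- Contraction with a vector field is an antiderivation. -/
lemma interior_mul_wedgeOne_add (v g : σ → MvPolynomial σ K) :
    interior v * wedgeOne g + wedgeOne g * interior v = mulFun (∑ j, v j * g j) := by
  have h : ∀ i j : σ, mulFun (v i) * contract i * (mulFun (g j) * wedge j) +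
      mulFun (g j) * wedge j * (mulFun (v i) * contract i) =
      if i = j then mulFun (v i * g j) else 0 := fun i j => by
    calc _ = mulFun (v i) * (contract i * mulFun (g j)) * wedge j +
          mulFun (g j) * (wedge j * mulFun (v i)) * contract i := by simp only [mul_assoc]
      _ = mulFun (v i) * mulFun (g j) * (contract i * wedge j) +
          mulFun (g j) * mulFun (v i) * (wedge j * contract i) := by
        rw [contract_mul_mulFun, wedge_mul_mulFun]; simp only [mul_assoc]
      _ = mulFun (v i * g j) * (contract i * wedge j + wedge j * contract i) := by
        rw [mulFun_comm (g j), mul_add, mulFun_mul]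
      _ = _ := by rw [contract_mul_wedge_add]; split_ifs <;> simp
  rw [interior, wedgeOne, Finset.sum_mul_sum, Finset.sum_mul_sum, Finset.sum_comm (s := Finset.univ)
    (f := fun i j => mulFun (g i) * wedge i * (mulFun (v j) * contract j))]
  simp_rw [← Finset.sum_add_distrib, h, mulFun_sum]
  simp

end PolyForm
end

noncomputable section

namespace PolyForm

variable {σ K : Type*} [Field K]

/-- The homogeneous component of form degree `k`. -/
def degPart (k : ℕ) : Module.End K (Form σ K) where
  toFun ω S := if S.card = k then ω S else 0
  map_add' ω η := by ext1 S; simp only [Pi.add_apply]; split_ifs <;> simp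
  map_smul' c ω := by ext1 S; simp only [Pi.smul_apply]; split_ifs <;> simp

lemma degPart_apply (k : ℕ) (ω : Form σ K) (S : Finset σ) :
    degPart k ω S = if S.card = k then ω S else 0 := rfl

lemma degPart_degPart (k : ℕ) (ω : Form σ K) : degPart k (degPart k ω) = degPart k ω :=
  funext fun S => by simp only [degPart_apply]; split_ifs <;> rfl

lemma degPart_mul_mulFun (k : ℕ) (a : MvPolynomial σ K) :
    degPart k * mulFun a = mulFun a * degPart k := by
  refine LinearMap.ext fun ω => funext fun S => ?_
  simp [degPart_apply]

lemma degPart_mul_partialD (k : ℕ) (j : σ) :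
    (degPart k * partialD j : Module.End K (Form σ K)) = partialD j * degPart k := by
  refine LinearMap.ext fun ω => funext fun S => ?_
  simp only [Module.End.mul_apply, degPart_apply, partialD_apply]
  split_ifs <;> simp

variable [LinearOrder σ]

lemma wedge_apply (j : σ) (ω : Form σ K) (S : Finset σ) :
    wedge j ω S = if j ∈ S then sgn j S • ω (S.erase j) else 0 := rfl

lemma contract_apply (j : σ) (ω : Form σ K) (S : Finset σ) :
    contract j ω S = if j ∈ S then 0 else sgn j S • ω (insert j S) := rfl

lemma degPart_succ_mul_wedge (k : ℕ) (j : σ) :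
    (degPart (k + 1) * wedge j : Module.End K (Form σ K)) = wedge j * degPart k := by
  refine LinearMap.ext fun ω => funext fun S => ?_
  simp only [Module.End.mul_apply, degPart_apply, wedge_apply]
  by_cases hj : j ∈ S
  · have := Finset.card_erase_add_one hj
    simp only [hj, if_true, ← this, Nat.add_right_cancel_iff, smul_ite, smul_zero]
  · simp [hj]

lemma degPart_zero_mul_wedge (j : σ) : (degPart 0 * wedge j : Module.End K (Form σ K)) = 0 := by
  refine LinearMap.ext fun ω => funext fun S => ?_
  simp only [Module.End.mul_apply, degPart_apply, wedge_apply, Finset.card_eq_zero]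
  split_ifs <;> simp_all

lemma degPart_mul_contract (k : ℕ) (j : σ) :
    (degPart k * contract j : Module.End K (Form σ K)) = contract j * degPart (k + 1) := by
  refine LinearMap.ext fun ω => funext fun S => ?_
  simp only [Module.End.mul_apply, degPart_apply, contract_apply]
  by_cases hj : j ∈ S
  · simp [hj]
  · simp only [hj, if_false, Finset.card_insert_of_notMem hj, Nat.add_right_cancel_iff, smul_ite,
      smul_zero]

variable [Fintype σ]

lemma degPart_succ_mul_extD (k : ℕ) :
    (degPart (k + 1) * extD : Module.End K (Form σ K)) = extD * degPart k := by
  simp_rw [extD, Finset.mul_sum, Finset.sum_mul, ← mul_assoc, degPart_succ_mul_wedge, mul_assoc,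
    degPart_mul_partialD]

lemma degPart_zero_mul_extD : (degPart 0 * extD : Module.End K (Form σ K)) = 0 := by
  simp_rw [extD, Finset.mul_sum, ← mul_assoc, degPart_zero_mul_wedge, zero_mul,
    Finset.sum_const_zero]

lemma degPart_mul_interior (k : ℕ) (v : σ → MvPolynomial σ K) :
    degPart k * interior v = interior v * degPart (k + 1) := by
  simp_rw [interior, Finset.mul_sum, Finset.sum_mul, ← mul_assoc, degPart_mul_mulFun, mul_assoc,
    degPart_mul_contract]

lemma degPart_succ_mul_wedgeOne (k : ℕ) (g : σ → MvPolynomial σ K) :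
    degPart (k + 1) * wedgeOne g = wedgeOne g * degPart k := by
  simp_rw [wedgeOne, Finset.mul_sum, Finset.sum_mul, ← mul_assoc, degPart_mul_mulFun, mul_assoc,
    degPart_succ_mul_wedge]

lemma degPart_zero_mul_wedgeOne (g : σ → MvPolynomial σ K) : degPart 0 * wedgeOne g = 0 := by
  simp_rw [wedgeOne, Finset.mul_sum, ← mul_assoc, degPart_mul_mulFun, mul_assoc,
    degPart_zero_mul_wedge, mul_zero, Finset.sum_const_zero]

omit [LinearOrder σ] in
lemma coeff_sum_X_mul_pderiv (p : MvPolynomial σ K) (m : σ →₀ ℕ) :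
    coeff m (∑ j, X j * pderiv j p) = m.degree * coeff m p := by
  induction p using MvPolynomial.induction_on' with
  | monomial s a =>
    simp_rw [X_mul_pderiv_monomial, ← Finset.sum_smul, ← Finsupp.degree_eq_sum]
    rw [coeff_smul, nsmul_eq_mul]
    rcases eq_or_ne s m with rfl | h
    · simp
    · classical simp [coeff_monomial, h]
  | add p q hp hq => simp only [map_add, mul_add, Finset.sum_add_distrib, coeff_add, hp, hq]

/-- The Cartan formula for the radial vector field. -/
lemma radial_homotopy (ω : Form σ K) (S : Finset σ) :
    (extD (interior X ω) + interior X (extD ω)) S =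
      ∑ j, X j * pderiv j (ω S) + S.card • ω S := by
  have h : ∀ i j : σ, (wedge i * partialD i * (mulFun (X j) * contract j) +
      mulFun (X j) * contract j * (wedge i * partialD i) : Module.End K (Form σ K)) =
      if j = i then mulFun (X i) * partialD i + wedge i * contract i else 0 := fun i j => by
    calc _ = wedge i * (partialD i * mulFun (X j)) * contract j +
          mulFun (X j) * (contract j * wedge i) * partialD i := by simp only [mul_assoc]
      _ = mulFun (X j) * (contract j * wedge i + wedge i * contract j) * partialD i +
          mulFun (pderiv i (X j)) * (wedge i * contract j) := by
        rw [partialD_mul_mulFun, mul_add, ← mul_assoc, wedge_mul_mulFun, wedge_mul_mulFun, add_mul,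
          mul_assoc, partialD_mul_contract, mul_add, add_mul]
        simp only [mul_assoc]
        abel
      _ = _ := by
        rw [contract_mul_wedge_add]
        rcases eq_or_ne j i with rfl | hij
        · simp [mulFun_one]
        · have : (mulFun 0 : Module.End K (Form σ K)) = 0 := LinearMap.ext fun ω => by ext1; simp
          simp [hij, pderiv_X_of_ne hij, this]
  have h2 : (extD * interior X + interior X * extD : Module.End K (Form σ K)) =
      ∑ i, (mulFun (X i) * partialD i + wedge i * contract i) := by
    rw [interior, extD, Finset.sum_mul_sum, Finset.sum_mul_sum, Finset.sum_comm (s := Finset.univ)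
      (f := fun i j => mulFun (X i) * contract i * (wedge j * partialD j))]
    simp_rw [← Finset.sum_add_distrib, h]
    simp
  have h3 : ∀ i, (wedge i (contract i ω)) S = if i ∈ S then ω S else 0 := fun i => by
    rw [wedge_apply, contract_apply]
    split_ifs with hi h'
    · simp at h'
    · rw [smul_smul, sgn_eq_erase i hi, Finset.insert_erase hi]
      simp [sgn_mul_self]
    · rfl
  have h4 := congrFun (LinearMap.congr_fun h2 ω) S
  simp only [LinearMap.add_apply, Module.End.mul_apply, LinearMap.sum_apply,
    Finset.sum_apply, Pi.add_apply, mulFun_apply, partialD_apply, h3,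
    Finset.sum_add_distrib] at h4
  rw [Pi.add_apply, h4]
  simp

variable [CharZero K]

omit [LinearOrder σ] in
lemma euler_injective {n : ℕ} (hn : n ≠ 0) (p : MvPolynomial σ K)
    (h : ∑ j, X j * pderiv j p + n • p = 0) : p = 0 := by
  ext m
  have := congrArg (coeff m) h
  rw [coeff_add, coeff_sum_X_mul_pderiv, coeff_smul, coeff_zero, nsmul_eq_mul, ← add_mul,
    ← Nat.cast_add, mul_eq_zero, Nat.cast_eq_zero] at this
  rcases this with h | h
  · omega
  · simpa using h

omit [LinearOrder σ] in
lemma euler_surjective {n : ℕ} (hn : n ≠ 0) (p : MvPolynomial σ K) :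
    ∃ q, ∑ j, X j * pderiv j q + n • q = p := by
  induction p using MvPolynomial.induction_on' with
  | monomial s a =>
    refine ⟨monomial s (a / (s.degree + n : ℕ)), ?_⟩
    simp_rw [X_mul_pderiv_monomial, ← Finset.sum_smul, ← Finsupp.degree_eq_sum]
    rw [← add_smul, smul_monomial, nsmul_eq_mul, mul_div_cancel₀]
    exact Nat.cast_ne_zero.2 (by omega)
  | add p q hp hq =>
    obtain ⟨p', rfl⟩ := hp
    obtain ⟨q', rfl⟩ := hq
    refine ⟨p' + q', ?_⟩
    simp only [map_add, mul_add, Finset.sum_add_distrib, smul_add]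
    abel

/-- The algebraic Poincaré lemma. -/
lemma exists_extD_eq {k : ℕ} {ω : Form σ K} (hk : degPart (k + 1) ω = ω) (hω : extD ω = 0) :
    ∃ ξ, degPart k ξ = ξ ∧ extD ξ = ω := by
  have hex : ∀ S : Finset σ, ∃ q, ∑ j, X j * pderiv j q + S.card • q = ω S := fun S => by
    by_cases hS : S.card = k + 1
    · exact euler_surjective (by omega) _
    · refine ⟨0, ?_⟩
      rw [← hk, degPart_apply, if_neg hS]
      simp
  choose ξ hξ using hex
  have hG : extD (interior X ξ) + interior X (extD ξ) = ω := funext fun S => by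
    rw [radial_homotopy, hξ]
  have hd2 : ∀ η : Form σ K, extD (extD η) = 0 := fun η => by
    rw [← Module.End.mul_apply, extD_mul_extD, LinearMap.zero_apply]
  have hdξ : extD ξ = 0 := funext fun S => by
    by_cases hS : S.card = 0
    · have := congrFun (LinearMap.congr_fun (degPart_zero_mul_extD (σ := σ) (K := K)) ξ) S
      simpa [degPart_apply, hS] using this
    · refine euler_injective hS _ ?_
      rw [← radial_homotopy, hd2, map_zero, add_zero]
      have := congrArg extD hG
      rw [map_add, hd2, zero_add, hω] at this
      rw [this]; rfl
  refine ⟨degPart k (interior X ξ), degPart_degPart _ _, ?_⟩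
  rw [← Module.End.mul_apply, ← degPart_succ_mul_extD, Module.End.mul_apply]
  rw [hdξ, map_zero, add_zero] at hG
  rw [hG, hk]

end PolyForm
end

noncomputable section

/-- A diagonalizable endomorphism `L` admits a projection onto its kernel which commutes with
every endomorphism commuting with `L`. -/
lemma exists_projection_ker_of_iSup_eigenspace_eq_top {K M : Type*} [Field K] [AddCommGroup M]
    [Module K M] (L : Module.End K M) (h : ⨆ μ, L.eigenspace μ = ⊤) :
    ∃ π : Module.End K M, (∀ v, L (π v) = 0) ∧ (∀ v, L v = 0 → π v = v) ∧
      ∀ T : Module.End K M, Commute T L → ∀ v, T (π v) = π (T v) := by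
  set G : Submodule K M := ⨆ μ, ⨆ _ : μ ≠ 0, L.eigenspace μ with hG
  have hc : IsCompl (L.eigenspace 0) G := by
    refine ⟨L.eigenspaces_iSupIndep 0, codisjoint_iff.2 (top_le_iff.1 (h ▸ iSup_le fun μ => ?_))⟩
    rcases eq_or_ne μ 0 with rfl | hμ
    · exact le_sup_left
    · exact le_sup_of_le_right (le_iSup₂_of_le μ hμ le_rfl)
  have hmem : ∀ v, v ∈ L.eigenspace 0 ↔ L v = 0 := fun v => by
    rw [Module.End.mem_eigenspace_iff, zero_smul]
  refine ⟨(L.eigenspace 0).projection G hc, fun v => (hmem _).1 (by simp), fun v hv => ?_,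
    fun T hT v => ?_⟩
  · simpa using Submodule.projection_apply_left hc ⟨v, (hmem v).2 hv⟩
  have hTμ : ∀ μ, ∀ u ∈ L.eigenspace μ, T u ∈ L.eigenspace μ := fun μ u hu => by
    rw [Module.End.mem_eigenspace_iff] at hu ⊢
    rw [← Module.End.mul_apply, ← hT.eq, Module.End.mul_apply, hu, map_smul]
  have hTG : G ≤ G.comap T := iSup₂_le fun μ hμ u hu =>
    (le_iSup₂_of_le (f := fun μ (_ : μ ≠ 0) => L.eigenspace μ) μ hμ le_rfl) (hTμ μ u hu)
  obtain ⟨a, ha, b, hb, rfl⟩ : ∃ a ∈ L.eigenspace 0, ∃ b ∈ G, a + b = v :=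
    Submodule.mem_sup.1 (hc.sup_eq_top ▸ Submodule.mem_top)
  have hl : ∀ u ∈ L.eigenspace 0, (L.eigenspace 0).projection G hc u = u := fun u hu => by
    simpa using Submodule.projection_apply_left hc ⟨u, hu⟩
  have hr : ∀ u ∈ G, (L.eigenspace 0).projection G hc u = 0 := fun u hu =>
    (Submodule.projection_apply_eq_zero_iff hc).2 hu
  simp only [map_add, hl a ha, hr b hb, hl _ (hTμ 0 a ha), hr _ (hTG hb), map_zero]

namespace PolyForm

variable {σ K : Type*} [Field K] [LinearOrder σ]

lemma contract_mul_degPart_zero (j : σ) :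
    (contract j * degPart 0 : Module.End K (Form σ K)) = 0 := by
  refine LinearMap.ext fun ω => funext fun S => ?_
  simp [contract_apply, degPart_apply]

variable [Fintype σ]

lemma interior_mul_degPart_zero (v : σ → MvPolynomial σ K) : interior v * degPart 0 = 0 := by
  simp_rw [interior, Finset.sum_mul, mul_assoc, contract_mul_degPart_zero, mul_zero,
    Finset.sum_const_zero]

/-- The Lie derivative along the vector field `∑ v_j ∂/∂x_j`. -/
def lieD (v : σ → MvPolynomial σ K) : Module.End K (Form σ K) :=
  extD * interior v + interior v * extD

lemma commute_degPart_lieD (k : ℕ) (v : σ → MvPolynomial σ K) :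
    Commute (degPart k) (lieD v) := by
  rw [commute_iff_eq, lieD, mul_add, add_mul, ← mul_assoc (degPart k) (interior v),
    degPart_mul_interior, mul_assoc (interior v), degPart_succ_mul_extD, mul_assoc (interior v)]
  congr 1
  cases k with
  | zero =>
    rw [← mul_assoc, degPart_zero_mul_extD, zero_mul, mul_assoc, interior_mul_degPart_zero,
      mul_zero]
  | succ k =>
    rw [← mul_assoc, degPart_succ_mul_extD, mul_assoc, degPart_mul_interior, mul_assoc]

/-- The function `1`, as a form. -/
def one : Form σ K := Pi.single ∅ 1

lemma extD_one : extD (one : Form σ K) = 0 := by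
  rw [extD, LinearMap.sum_apply]
  refine Finset.sum_eq_zero fun j _ => ?_
  have : partialD j (one : Form σ K) = 0 := funext fun S => by
    rw [partialD_apply, one, Pi.single_apply]
    split_ifs <;> simp
  rw [Module.End.mul_apply, this, map_zero]

lemma interior_one (v : σ → MvPolynomial σ K) : interior v one = 0 := by
  rw [interior, LinearMap.sum_apply]
  refine Finset.sum_eq_zero fun j _ => funext fun S => ?_
  simp [contract_apply, one]

omit [Fintype σ] in
lemma degPart_succ_one (k : ℕ) : degPart (k + 1) (one : Form σ K) = 0 := funext fun S => by
  rw [degPart_apply, one, Pi.single_apply]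
  split_ifs <;> simp_all

omit [Fintype σ] [LinearOrder σ] in
lemma eq_zero_of_degPart_eq_zero {ω : Form σ K} (h : ∀ k, degPart k ω = 0) : ω = 0 :=
  funext fun S => by simpa [degPart_apply] using congrFun (h S.card) S

omit [LinearOrder σ] in
lemma degPart_eq_zero_of_card_lt {k : ℕ} (hk : Fintype.card σ < k) (ω : Form σ K) :
    degPart k ω = 0 := funext fun S => by
  rw [degPart_apply, if_neg (S.card_le_univ.trans_lt hk).ne]
  rfl

/-- The equivariant differential. -/
def equivD (v : σ → MvPolynomial σ K) : Module.End K (Form σ K) := extD + interior v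

lemma equivD_apply (v : σ → MvPolynomial σ K) (ω : Form σ K) :
    equivD v ω = extD ω + interior v ω := rfl

variable [CharZero K]

lemma commute_extD_lieD (v : σ → MvPolynomial σ K) : Commute extD (lieD v) := by
  rw [commute_iff_eq, lieD, mul_add, add_mul, ← mul_assoc, extD_mul_extD, zero_mul, mul_assoc,
    mul_assoc, extD_mul_extD, mul_zero, zero_add, add_zero]

lemma commute_interior_lieD (v : σ → MvPolynomial σ K) : Commute (interior v) (lieD v) := by
  rw [commute_iff_eq, lieD, mul_add, add_mul, ← mul_assoc _ (interior v), interior_mul_interior,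
    zero_mul, mul_assoc, interior_mul_interior, mul_zero, zero_add, add_zero, mul_assoc]

lemma equivD_equivD (v : σ → MvPolynomial σ K) (ω : Form σ K) :
    equivD v (equivD v ω) = lieD v ω := by
  have h1 := LinearMap.congr_fun (extD_mul_extD (σ := σ) (K := K)) ω
  have h2 := LinearMap.congr_fun (interior_mul_interior v) ω
  simp only [Module.End.mul_apply, LinearMap.zero_apply] at h1 h2
  simp only [equivD_apply, map_add, h1, h2, lieD, LinearMap.add_apply, Module.End.mul_apply,
    zero_add, add_zero]
  abel

lemma commute_equivD_lieD (v : σ → MvPolynomial σ K) : Commute (equivD v) (lieD v) :=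
  (commute_extD_lieD v).add_left (commute_interior_lieD v)

/-- If the diagonalizable vector field `v` has no zeros, then `1` is equivariantly exact. -/
lemma exists_equivD_eq_one (v g : σ → MvPolynomial σ K) (hL : ⨆ μ, (lieD v).eigenspace μ = ⊤)
    (hg : ∑ j, v j * g j = 1) : ∃ β, lieD v β = 0 ∧ equivD v β = one := by
  obtain ⟨π, hπ, hπid, hπc⟩ := exists_projection_ker_of_iSup_eigenspace_eq_top _ hL
  have key : ∀ m, ∃ β, lieD v β = 0 ∧ ∀ k < m, degPart k (one - equivD v β) = 0 := by
    intro m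
    induction m with
    | zero => exact ⟨0, map_zero _, by simp⟩
    | succ m ih =>
      obtain ⟨β, hβ, hη⟩ := ih
      set η := one - equivD v β with hη'
      have hDη : equivD v η = 0 := by
        rw [hη', map_sub, equivD_equivD, hβ, equivD_apply, extD_one, interior_one]
        simp
      have hLη : lieD v η = 0 := by rw [← equivD_equivD, hDη, map_zero]
      have hιT : interior v (wedgeOne g η) + wedgeOne g (interior v η) = η := by
        have := LinearMap.congr_fun (interior_mul_wedgeOne_add v g) η
        rwa [hg, mulFun_one] at this
      set M := extD (wedgeOne g η) + wedgeOne g (extD η) with hM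
      have hDT : equivD v (wedgeOne g η) = η + M := by
        have h1 : wedgeOne g (equivD v η) = 0 := by rw [hDη, map_zero]
        rw [equivD_apply, map_add] at h1
        rw [equivD_apply, eq_sub_of_add_eq hιT, hM, eq_neg_of_add_eq_zero_right h1]
        abel
      refine ⟨β + π (wedgeOne g η), by rw [map_add, hβ, hπ, add_zero], fun k hk => ?_⟩
      have h2 : one - equivD v (β + π (wedgeOne g η)) = -π M := by
        rw [map_add, hπc _ (commute_equivD_lieD v), hDT, map_add, hπid η hLη, hη']
        abel
      have h3 : degPart k M = 0 := by
        have e1 := fun k => LinearMap.congr_fun (degPart_succ_mul_extD (σ := σ) (K := K) k)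
        have e2 := fun k => LinearMap.congr_fun (degPart_succ_mul_wedgeOne k g)
        have e3 := LinearMap.congr_fun (degPart_zero_mul_extD (σ := σ) (K := K))
        have e4 := LinearMap.congr_fun (degPart_zero_mul_wedgeOne g)
        simp only [Module.End.mul_apply, LinearMap.zero_apply] at e1 e2 e3 e4
        rw [hM, map_add]
        match k with
        | 0 => rw [e3, e4, add_zero]
        | 1 => rw [e1, e4, e2, e3, map_zero, map_zero, add_zero]
        | k + 2 => rw [e1, e2, e2, e1, hη k (by omega), map_zero, map_zero, map_zero, add_zero]
      rw [h2, map_neg, hπc _ (commute_degPart_lieD k v), h3, map_zero, neg_zero]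
  obtain ⟨β, hβ, h⟩ := key (Fintype.card σ + 1)
  refine ⟨β, hβ, (sub_eq_zero.1 (eq_zero_of_degPart_eq_zero fun k => ?_)).symm⟩
  by_cases hk : k < Fintype.card σ + 1
  · exact h k hk
  · exact degPart_eq_zero_of_card_lt (by omega) _

/-- On affine space, `1` is never equivariantly exact. -/
lemma equivD_ne_one (v : σ → MvPolynomial σ K) (hL : ⨆ μ, (lieD v).eigenspace μ = ⊤)
    (β : Form σ K) (hβ : lieD v β = 0) : equivD v β ≠ one := by
  obtain ⟨π, hπ, hπid, hπc⟩ := exists_projection_ker_of_iSup_eigenspace_eq_top _ hL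
  have ed := fun k => LinearMap.congr_fun (degPart_succ_mul_extD (σ := σ) (K := K) k)
  have ei := fun k => LinearMap.congr_fun (degPart_mul_interior k v)
  have ed0 := LinearMap.congr_fun (degPart_zero_mul_extD (σ := σ) (K := K))
  simp only [Module.End.mul_apply, LinearMap.zero_apply] at ed ei ed0
  have key : ∀ m, ∀ β : Form σ K, lieD v β = 0 → (∀ k > m, degPart k β = 0) →
      equivD v β ≠ one := by
    intro m
    induction m with
    | zero =>
      intro β _ hdeg h
      have h1 := congrArg (degPart 0) h
      rw [equivD_apply, map_add, ed0, ei, hdeg 1 one_pos, map_zero, add_zero] at h1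
      simpa [degPart_apply, one] using congrFun h1 ∅
    | succ m ih =>
      intro β hβ hdeg h
      have hdω : extD (degPart (m + 1) β) = 0 := by
        have h1 := congrArg (degPart (m + 1 + 1)) h
        rwa [equivD_apply, map_add, ei, hdeg (m + 1 + 1 + 1) (by omega), map_zero, add_zero, ed,
          degPart_succ_one] at h1
      obtain ⟨ξ, hξ, hdξ⟩ := exists_extD_eq (degPart_degPart (m + 1) β) hdω
      have hω : π (degPart (m + 1) β) = degPart (m + 1) β := by
        rw [← hπc _ (commute_degPart_lieD _ v), hπid β hβ]
      have hdγ : extD (π ξ) = degPart (m + 1) β := by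
        rw [hπc _ (commute_extD_lieD v), hdξ, hω]
      have hγ : degPart m (π ξ) = π ξ := by rw [hπc _ (commute_degPart_lieD _ v), hξ]
      refine ih (β - equivD v (π ξ)) ?_ (fun k hk => ?_) ?_
      · rw [map_sub, hβ, ← Module.End.mul_apply, ← (commute_equivD_lieD v).eq,
          Module.End.mul_apply, hπ, map_zero, sub_zero]
      · have h2 : degPart (k + 1) (π ξ) = 0 := by
          rw [← hγ]
          funext S
          simp only [degPart_apply]
          split_ifs <;> first | omega | rfl
        rw [equivD_apply, map_sub, map_add, ei, h2, map_zero, add_zero, hdγ]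
        rcases eq_or_ne k (m + 1) with rfl | hkm
        · rw [degPart_degPart, sub_self]
        · rw [hdeg k (by omega), zero_sub, neg_eq_zero]
          funext S
          simp only [degPart_apply]
          split_ifs <;> first | omega | rfl
      · rw [map_sub, equivD_equivD, hπ, sub_zero, h]
  exact key _ β hβ fun k hk => degPart_eq_zero_of_card_lt hk β

end PolyForm
end

noncomputable section

namespace PolyForm

variable {σ K : Type*} [Field K] [LinearOrder σ] [Fintype σ]

lemma lieD_mulFun (v : σ → MvPolynomial σ K) (a : MvPolynomial σ K) (ω : Form σ K) :
    lieD v (mulFun a ω) = mulFun a (lieD v ω) + mulFun (∑ j, v j * pderiv j a) ω := by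
  have h1 := LinearMap.congr_fun (interior_mul_mulFun v a)
  have h2 := LinearMap.congr_fun (extD_mul_mulFun a)
  have h3 := LinearMap.congr_fun (interior_mul_wedgeOne_add v fun j => pderiv j a)
  simp only [Module.End.mul_apply, LinearMap.add_apply] at h1 h2 h3
  simp only [lieD, Module.End.mul_apply, LinearMap.add_apply, h1, h2, map_add, ← h3]
  abel

lemma wedgeOne_pderiv_apply (a : MvPolynomial σ K) (ω : Form σ K) :
    wedgeOne (fun j => pderiv j a) ω = extD (mulFun a ω) - mulFun a (extD ω) := by
  have h2 := LinearMap.congr_fun (extD_mul_mulFun a) ω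
  simp only [Module.End.mul_apply, LinearMap.add_apply] at h2
  rw [h2, add_sub_cancel_left]

lemma wedgeOne_smul (c : K) (g : σ → MvPolynomial σ K) : wedgeOne (c • g) = c • wedgeOne g := by
  rw [wedgeOne, wedgeOne, Finset.smul_sum]
  refine Finset.sum_congr rfl fun j _ => LinearMap.ext fun ω => funext fun S => ?_
  simp

omit [Fintype σ] in
lemma single_insert_eq {j : σ} {S : Finset σ} (hj : j ∉ S) (a : MvPolynomial σ K) :
    (Pi.single (insert j S) a : Form σ K) = sgn j (insert j S) • wedge j (Pi.single S a) := by
  funext U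
  rw [Pi.smul_apply, wedge_apply, Pi.single_apply, Pi.single_apply]
  by_cases hU : U = insert j S
  · subst hU
    simp only [Finset.mem_insert_self, if_true, Finset.erase_insert hj, smul_smul, sgn_mul_self,
      one_smul]
  · rw [if_neg hU]
    split_ifs with h1 h2
    · exact absurd (by rw [← h2, Finset.insert_erase h1]) hU
    · simp
    · simp

omit [Fintype σ] in
lemma mulFun_one_form (a : MvPolynomial σ K) : mulFun a one = Pi.single ∅ a := funext fun S => by
  rw [mulFun_apply, one, Pi.single_apply, Pi.single_apply]
  split_ifs <;> simp

variable [CharZero K]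

lemma lieD_wedgeOne_pderiv (v : σ → MvPolynomial σ K) (a : MvPolynomial σ K) (ω : Form σ K) :
    lieD v (wedgeOne (fun j => pderiv j a) ω) = wedgeOne (fun j => pderiv j a) (lieD v ω) +
      wedgeOne (fun k => pderiv k (∑ j, v j * pderiv j a)) ω := by
  have h1 := LinearMap.congr_fun (commute_extD_lieD v).eq
  simp only [Module.End.mul_apply] at h1
  simp only [wedgeOne_pderiv_apply, map_sub, ← h1, lieD_mulFun, map_add]
  abel

/-- The Lie derivative along a vector field is diagonalizable on forms if it is so on functions and
the cotangent bundle has a frame of differentials of eigenfunctions. -/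
lemma iSup_eigenspace_lieD_eq_top (v : σ → MvPolynomial σ K)
    (hv : ∀ a, a ∈ Submodule.span K {a | ∃ μ : K, ∑ j, v j * pderiv j a = μ • a})
    (P : σ → MvPolynomial σ K) (c : σ → K) (hP : ∀ i, ∑ j, v j * pderiv j (P i) = c i • P i)
    (G : σ → σ → MvPolynomial σ K)
    (hG : ∀ k j, ∑ i, G k i * pderiv j (P i) = if j = k then 1 else 0) :
    ⨆ μ, (lieD v).eigenspace μ = ⊤ := by
  set V := ⨆ μ, (lieD v).eigenspace μ with hV
  have hshift : ∀ (T : Module.End K (Form σ K)) (μ : K),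
      (∀ ω, lieD v (T ω) = T (lieD v ω) + μ • T ω) → ∀ ω ∈ V, T ω ∈ V := fun T μ hT => by
    have : V ≤ V.comap T := iSup_le fun ν ω hω => by
      refine Submodule.mem_iSup_of_mem (ν + μ) ?_
      rw [Module.End.mem_eigenspace_iff] at hω ⊢
      rw [hT, hω, map_smul, add_smul]
    exact this
  have hmul : ∀ a, ∀ ω ∈ V, mulFun a ω ∈ V := fun a => by
    induction hv a using Submodule.span_induction with
    | mem a ha =>
      obtain ⟨μ, hμ⟩ := ha
      refine hshift _ μ fun ω => ?_
      rw [lieD_mulFun, hμ]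
      congr 1
      funext S
      simp
    | zero =>
      intro ω _
      convert V.zero_mem
      funext S
      simp
    | add a b _ _ ha hb =>
      intro ω hω
      convert V.add_mem (ha ω hω) (hb ω hω)
      funext S
      simp [add_mul]
    | smul t a _ ha =>
      intro ω hω
      convert V.smul_mem t (ha ω hω)
      funext S
      simp
  have hdP : ∀ i, ∀ ω ∈ V, wedgeOne (fun j => pderiv j (P i)) ω ∈ V := fun i =>
    hshift _ (c i) fun ω => by
      have h : (fun k => pderiv k (c i • P i)) = c i • fun k => pderiv k (P i) :=
        funext fun k => by simp
      rw [lieD_wedgeOne_pderiv, hP, h, wedgeOne_smul, LinearMap.smul_apply]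
  have hwedge : ∀ k, ∀ ω ∈ V, wedge k ω ∈ V := fun k ω hω => by
    have : wedge k = ∑ i, mulFun (G k i) * wedgeOne (fun j => pderiv j (P i)) := by
      simp_rw [wedgeOne, Finset.mul_sum, ← mul_assoc, ← mulFun_mul]
      rw [Finset.sum_comm]
      simp_rw [← Finset.sum_mul, ← mulFun_sum, hG]
      rw [Finset.sum_eq_single k]
      · simp [mulFun_one]
      · intro b _ hb
        refine LinearMap.ext fun ω => funext fun S => ?_
        simp [hb]
      · simp
    rw [this, LinearMap.sum_apply]
    exact V.sum_mem fun i _ => hmul _ _ (hdP i ω hω)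
  have hone : one ∈ V := Submodule.mem_iSup_of_mem 0 <| by
    rw [Module.End.mem_eigenspace_iff, zero_smul, lieD, LinearMap.add_apply, Module.End.mul_apply,
      Module.End.mul_apply, extD_one, interior_one, map_zero, map_zero, add_zero]
  have hsingle : ∀ (S : Finset σ) (a : MvPolynomial σ K), (Pi.single S a : Form σ K) ∈ V := by
    intro S
    induction S using Finset.induction_on with
    | empty => exact fun a => mulFun_one_form a ▸ hmul a one hone
    | insert j S hj ih =>
      intro a
      rw [single_insert_eq hj]
      exact V.toAddSubgroup.zsmul_mem (hwedge j _ (ih a)) _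
  refine top_le_iff.1 fun ω _ => ?_
  rw [← Finset.univ_sum_single ω]
  exact V.sum_mem fun S _ => hsingle S _

/-- A diagonalizable vector field on affine space with a frame of differentials of eigenfunctions
has a zero. -/
theorem sum_mul_ne_one (v : σ → MvPolynomial σ K)
    (hv : ∀ a, a ∈ Submodule.span K {a | ∃ μ : K, ∑ j, v j * pderiv j a = μ • a})
    (P : σ → MvPolynomial σ K) (c : σ → K) (hP : ∀ i, ∑ j, v j * pderiv j (P i) = c i • P i)
    (G : σ → σ → MvPolynomial σ K)
    (hG : ∀ k j, ∑ i, G k i * pderiv j (P i) = if j = k then 1 else 0)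
    (g : σ → MvPolynomial σ K) : ∑ j, v j * g j ≠ 1 := fun hg => by
  have hL := iSup_eigenspace_lieD_eq_top v hv P c hP G hG
  obtain ⟨β, hβ, h⟩ := exists_equivD_eq_one v g hL hg
  exact equivD_ne_one v hL β hβ h

end PolyForm
end

section ComplexTorus

lemma isUnit_of_forall_eval_ne_zero {σ K : Type*} [Field K] [IsAlgClosed K] [Finite σ]
    (p : MvPolynomial σ K) (hp : ∀ x, eval x p ≠ 0) : IsUnit p := by
  by_contra h
  obtain ⟨I, hI, hpI⟩ := exists_max_ideal_of_mem_nonunits h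
  obtain ⟨x, rfl⟩ := eq_vanishingIdeal_singleton_of_isMaximal K hI
  rw [mem_vanishingIdeal_singleton_iff, aeval_eq_eval] at hpI
  exact hp x hpI

lemma hasDerivAt_eval_comp {σ : Type*} [Fintype σ] {γ : σ → ℂ → ℂ} {u : σ → ℂ} {s : ℂ}
    (hγ : ∀ i, HasDerivAt (γ i) (u i) s) (b : MvPolynomial σ ℂ) :
    HasDerivAt (fun t => eval (fun i => γ i t) b)
      (∑ j, u j * eval (fun i => γ i s) (pderiv j b)) s := by
  classical
  induction b using MvPolynomial.induction_on with
  | C c => simpa using hasDerivAt_const s c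
  | add p q hp hq => simpa [mul_add, Finset.sum_add_distrib] using hp.fun_add hq
  | mul_X p i hp =>
    simp only [map_mul, eval_X]
    refine (hp.mul (hγ i)).congr_deriv ?_
    simp only [Derivation.leibniz, pderiv_X, smul_eq_mul, map_add, map_mul, eval_X, mul_add,
      Finset.sum_add_distrib, Finset.sum_mul]
    rw [add_comm]
    congr 1
    · simp [Pi.single_apply, apply_ite, mul_comm]
    · exact Finset.sum_congr rfl fun j _ => by ring

variable {r : ℕ} {α : ℂˣ → (Fin r → ℂ) → (Fin r → ℂ)} {N : ℕ}
  {Q : Fin r → MvPolynomial (Fin (r + 1)) ℂ}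

lemma exists_pow_mul_eval_action_eq
    (hQ : ∀ (t : ℂˣ) (x : Fin r → ℂ) (i : Fin r),
      (t : ℂ) ^ N * α t x i = eval (Fin.cons (t : ℂ) x) (Q i)) (a : MvPolynomial (Fin r) ℂ) :
    ∃ (M : ℕ) (R : MvPolynomial (Fin (r + 1)) ℂ), ∀ (t : ℂˣ) (x : Fin r → ℂ),
      (t : ℂ) ^ M * eval (α t x) a = eval (Fin.cons (t : ℂ) x) R := by
  induction a using MvPolynomial.induction_on with
  | C c => exact ⟨0, C c, by simp⟩
  | add p q hp hq =>
    obtain ⟨M₁, R₁, h₁⟩ := hp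
    obtain ⟨M₂, R₂, h₂⟩ := hq
    refine ⟨M₁ + M₂, X 0 ^ M₂ * R₁ + X 0 ^ M₁ * R₂, fun t x => ?_⟩
    simp only [map_add, map_mul, map_pow, eval_X, Fin.cons_zero, ← h₁, ← h₂]
    ring
  | mul_X p i hp =>
    obtain ⟨M, R, h⟩ := hp
    refine ⟨M + N, R * Q i, fun t x => ?_⟩
    simp only [map_mul, eval_X, ← h, ← hQ]
    ring

/-- Every polynomial is a finite sum of weight vectors for an algebraic action of the torus. -/
lemma exists_sum_weight_eq (hα1 : α 1 = id) (hαmul : ∀ s t : ℂˣ, α (s * t) = α s ∘ α t)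
    (hQ : ∀ (t : ℂˣ) (x : Fin r → ℂ) (i : Fin r),
      (t : ℂ) ^ N * α t x i = eval (Fin.cons (t : ℂ) x) (Q i)) (a : MvPolynomial (Fin r) ℂ) :
    ∃ (M d : ℕ) (b : ℕ → MvPolynomial (Fin r) ℂ), a = ∑ n ∈ Finset.range d, b n ∧
      ∀ (n : ℕ) (s : ℂˣ) (x : Fin r → ℂ),
        (s : ℂ) ^ M * eval (α s x) (b n) = eval x (b n) * (s : ℂ) ^ n := by
  obtain ⟨M, R, h⟩ := exists_pow_mul_eval_action_eq hQ a
  simp only [eval_eq_eval_mv_eval'] at h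
  set R' := finSuccEquiv ℂ r R
  refine ⟨M, R'.natDegree + 1, R'.coeff, ?_, fun n s x => ?_⟩
  · refine MvPolynomial.funext fun x => ?_
    have h1 := h 1 x
    rw [Polynomial.eval_eq_sum_range' (n := R'.natDegree + 1)
      (Nat.lt_succ_of_le Polynomial.natDegree_map_le)] at h1
    simpa [hα1] using h1
  · have key : Polynomial.C ((s : ℂ) ^ M) * Polynomial.map (eval (α s x)) R' =
        (Polynomial.map (eval x) R').comp (Polynomial.C (s : ℂ) * Polynomial.X) := by
      refine Polynomial.eq_of_infinite_eval_eq _ _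
        ((Set.finite_singleton (0 : ℂ)).infinite_compl.mono fun t ht => ?_)
      lift t to ℂˣ using isUnit_iff_ne_zero.2 ht
      have h1 := h t (α s x)
      have h2 := h (t * s) x
      rw [hαmul, Units.val_mul, mul_pow] at h2
      simp only [Set.mem_ofPred_eq, Polynomial.eval_mul, Polynomial.eval_C, Polynomial.eval_comp,
        Polynomial.eval_X, ← h1]
      rw [mul_comm (s : ℂ) t, ← h2, Function.comp_apply]
      ring
    rw [← Polynomial.coeff_map (eval x), ← Polynomial.comp_C_mul_X_coeff, ← key,
      Polynomial.coeff_C_mul, Polynomial.coeff_map]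

/-- The tangent vector at the identity of an orbit of the action. -/
lemma exists_tangent (hα1 : α 1 = id)
    (hQ : ∀ (t : ℂˣ) (x : Fin r → ℂ) (i : Fin r),
      (t : ℂ) ^ N * α t x i = eval (Fin.cons (t : ℂ) x) (Q i)) (x : Fin r → ℂ) :
    ∃ u : Fin r → ℂ, ∀ (b : MvPolynomial (Fin r) ℂ) (M n : ℕ),
      (∀ s : ℂˣ, (s : ℂ) ^ M * eval (α s x) b = eval x b * (s : ℂ) ^ n) →
      ∑ j, u j * eval x (pderiv j b) = ((n : ℂ) - M) * eval x b := by
  let γ : Fin r → ℂ → ℂ := fun i s =>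
    eval (fun k => (Fin.cons (fun t => t) (fun k _ => x k) : Fin (r + 1) → ℂ → ℂ) k s) (Q i) / s ^ N
  have hcons : ∀ s : ℂ,
      (fun k => (Fin.cons (fun t => t) (fun k _ => x k) : Fin (r + 1) → ℂ → ℂ) k s) =
        Fin.cons s x := fun s => by
    ext k
    refine Fin.cases ?_ (fun k => ?_) k <;> simp
  have hγ : ∀ (s : ℂˣ), (fun i => γ i s) = α s x := fun s => by
    ext i
    simp only [γ, hcons, ← hQ]
    field_simp
  have hγ1 : (fun i => γ i 1) = x := by simpa [hα1] using hγ 1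
  have hdiff : ∀ i, DifferentiableAt ℂ (γ i) 1 := fun i => by
    refine DifferentiableAt.div ?_ (by fun_prop) (by simp)
    refine (hasDerivAt_eval_comp (u := Fin.cons 1 fun _ => 0) (fun k => ?_) (Q i)).differentiableAt
    refine Fin.cases ?_ (fun k => ?_) k
    · simpa using hasDerivAt_id' (1 : ℂ)
    · simpa using hasDerivAt_const (1 : ℂ) (x k)
  refine ⟨fun i => deriv (γ i) 1, fun b M n hb => ?_⟩
  have h1 := (hasDerivAt_pow M (1 : ℂ)).mul
    (hasDerivAt_eval_comp (fun i => (hdiff i).hasDerivAt) b)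
  have h2 := (hasDerivAt_pow n (1 : ℂ)).const_mul (eval x b)
  have h3 := h1.unique (h2.congr_of_eventuallyEq (by
    filter_upwards [isOpen_ne.mem_nhds (one_ne_zero (α := ℂ))] with s hs
    lift s to ℂˣ using isUnit_iff_ne_zero.2 hs
    simp only [Pi.mul_apply, hγ]
    exact hb s))
  simp only [hγ1, one_pow, mul_one, one_mul] at h3
  linear_combination h3

lemma mem_span_eigenvector (hα1 : α 1 = id) (hαmul : ∀ s t : ℂˣ, α (s * t) = α s ∘ α t)
    (hQ : ∀ (t : ℂˣ) (x : Fin r → ℂ) (i : Fin r),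
      (t : ℂ) ^ N * α t x i = eval (Fin.cons (t : ℂ) x) (Q i))
    (P : Fin r → MvPolynomial (Fin r) ℂ) (w : Fin r → ℤ) (hw : ∀ i, 0 < w i)
    (hequiv : ∀ (t : ℂˣ) (x : Fin r → ℂ) (i : Fin r),
      eval (α t x) (P i) = (t : ℂ) ^ (-(w i)) * eval x (P i))
    (G : Fin r → Fin r → MvPolynomial (Fin r) ℂ)
    (hG : ∀ k j, ∑ i, G k i * pderiv j (P i) = if j = k then 1 else 0)
    (a : MvPolynomial (Fin r) ℂ) :
    a ∈ Submodule.span ℂ {a | ∃ n : ℤ,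
      ∑ j, (∑ i, (w i : ℂ) • (G j i * P i)) * pderiv j a = (n : ℂ) • a} := by
  obtain ⟨M, d, b, rfl, hb⟩ := exists_sum_weight_eq hα1 hαmul hQ a
  refine Submodule.sum_mem _ fun n _ => Submodule.subset_span ⟨M - n, ?_⟩
  refine MvPolynomial.funext fun x => ?_
  obtain ⟨u, hu⟩ := exists_tangent hα1 hQ x
  have hP : ∀ i, ∑ j, u j * eval x (pderiv j (P i)) = -(w i : ℂ) * eval x (P i) := fun i => by
    have hwi : ((w i).toNat : ℤ) = w i := Int.toNat_of_nonneg (hw i).le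
    have h := hu (P i) (w i).toNat 0 fun s => by
      rw [hequiv, ← zpow_natCast, hwi, ← mul_assoc, ← zpow_add₀ s.ne_zero]
      simp
    rw [h, ← Int.cast_natCast (w i).toNat, hwi]
    simp
  have hv : ∀ k, eval x (∑ i, (w i : ℂ) • (G k i * P i)) = -u k := fun k => by
    have h : ∑ j, u j * eval x (∑ i, G k i * pderiv j (P i)) = u k := by
      simp [hG, apply_ite]
    rw [← h]
    simp only [map_sum, map_mul, smul_eval, Finset.mul_sum]
    rw [Finset.sum_comm, ← Finset.sum_neg_distrib]
    refine Finset.sum_congr rfl fun i _ => ?_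
    calc (w i : ℂ) * (eval x (G k i) * eval x (P i))
        = - (eval x (G k i) * (-(w i : ℂ) * eval x (P i))) := by ring
      _ = _ := by
        rw [← hP, Finset.mul_sum]
        exact congrArg _ (Finset.sum_congr rfl fun j _ => by ring)
  rw [map_sum]
  simp only [map_mul, hv, smul_eval, neg_mul, Finset.sum_neg_distrib]
  rw [hu (b n) M n fun s => hb n s x]
  push_cast
  ring

end ComplexTorus

section DualFrame

variable {σ K : Type*} [Field K]

lemma derivation_sum_apply {ι : Type*} (s : Finset ι)
    (D : ι → Derivation K (MvPolynomial σ K) (MvPolynomial σ K)) (a : MvPolynomial σ K) :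
    (∑ i ∈ s, D i) a = ∑ i ∈ s, D i a := by
  have h := congrFun (map_sum Derivation.coeFnAddMonoidHom D s) a
  rwa [Finset.sum_apply] at h

variable [Fintype σ]

lemma derivation_apply_eq_sum (D : Derivation K (MvPolynomial σ K) (MvPolynomial σ K))
    (a : MvPolynomial σ K) : D a = ∑ j, D (X j) * pderiv j a := by
  classical
  have h : D = ∑ j, D (X j) • pderiv j :=
    MvPolynomial.derivation_ext fun k => by
      simp [derivation_sum_apply, pderiv_X, Pi.single_apply]
  conv_lhs => rw [h]
  simp [derivation_sum_apply]

/-- The dual frame of vector fields attached to the inverse `G` of a Jacobian matrix. -/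
noncomputable def dualField (G : σ → σ → MvPolynomial σ K) (i : σ) :
    Derivation K (MvPolynomial σ K) (MvPolynomial σ K) :=
  ∑ j, G j i • pderiv j

lemma dualField_apply (G : σ → σ → MvPolynomial σ K) (i : σ) (a : MvPolynomial σ K) :
    dualField G i a = ∑ j, G j i * pderiv j a := by
  simp [dualField, derivation_sum_apply]

/-- The Euler vector field with weights `w` in the coordinates `P`. -/
noncomputable def eulerField (P : σ → MvPolynomial σ K) (G : σ → σ → MvPolynomial σ K)
    (w : σ → ℤ) : Derivation K (MvPolynomial σ K) (MvPolynomial σ K) :=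
  ∑ i, ((w i : K) • P i) • dualField G i

lemma eulerField_apply (P : σ → MvPolynomial σ K) (G : σ → σ → MvPolynomial σ K) (w : σ → ℤ)
    (a : MvPolynomial σ K) :
    eulerField P G w a = ∑ i, (w i : K) • (P i * dualField G i a) := by
  simp [eulerField, derivation_sum_apply]

lemma eulerField_apply_eq_sum_pderiv (P : σ → MvPolynomial σ K) (G : σ → σ → MvPolynomial σ K)
    (w : σ → ℤ) (a : MvPolynomial σ K) :
    eulerField P G w a = ∑ j, (∑ i, (w i : K) • (G j i * P i)) * pderiv j a := by
  simp only [eulerField_apply, dualField_apply, Finset.mul_sum, Finset.smul_sum, Finset.sum_mul]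
  rw [Finset.sum_comm]
  refine Finset.sum_congr rfl fun j _ => Finset.sum_congr rfl fun i _ => ?_
  rw [smul_mul_assoc]
  congr 1
  ring

variable {P : σ → MvPolynomial σ K} {G : σ → σ → MvPolynomial σ K} {w : σ → ℤ}
  [DecidableEq σ]

lemma derivation_eq_of_eq_on
    (hG : ∀ k j, ∑ i, G k i * pderiv j (P i) = if j = k then 1 else 0)
    {D₁ D₂ : Derivation K (MvPolynomial σ K) (MvPolynomial σ K)}
    (h : ∀ i, D₁ (P i) = D₂ (P i)) : D₁ = D₂ := by
  have key : ∀ (D : Derivation K (MvPolynomial σ K) (MvPolynomial σ K)) (k : σ),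
      D (X k) = ∑ i, G k i * D (P i) := fun D k => by
    calc D (X k) = ∑ j, D (X j) * ∑ i, G k i * pderiv j (P i) := by simp [hG]
      _ = _ := by
        simp only [derivation_apply_eq_sum D (P _), Finset.mul_sum]
        rw [Finset.sum_comm]
        exact Finset.sum_congr rfl fun i _ => Finset.sum_congr rfl fun j _ => by ring
  exact MvPolynomial.derivation_ext fun k => by simp only [key, h]

lemma dualField_apply_self
    (hG' : ∀ i k, ∑ j, pderiv j (P i) * G j k = if i = k then 1 else 0) (i k : σ) :
    dualField G k (P i) = if i = k then 1 else 0 := by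
  simp only [dualField_apply, ← hG', mul_comm]

lemma eulerField_apply_self
    (hG' : ∀ i k, ∑ j, pderiv j (P i) * G j k = if i = k then 1 else 0) (i : σ) :
    eulerField P G w (P i) = (w i : K) • P i := by
  simp [eulerField_apply, dualField_apply_self hG']

lemma pderiv_eq_sum_dualField
    (hG : ∀ k j, ∑ i, G k i * pderiv j (P i) = if j = k then 1 else 0)
    (hG' : ∀ i k, ∑ j, pderiv j (P i) * G j k = if i = k then 1 else 0)
    (j : σ) (a : MvPolynomial σ K) :
    pderiv j a = ∑ i, pderiv j (P i) * dualField G i a := by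
  have h : pderiv j = ∑ i, pderiv j (P i) • dualField G i :=
    derivation_eq_of_eq_on hG fun k => by
      simp [derivation_sum_apply, dualField_apply_self hG']
  conv_lhs => rw [h]
  simp [derivation_sum_apply]

lemma eulerField_dualField
    (hG : ∀ k j, ∑ i, G k i * pderiv j (P i) = if j = k then 1 else 0)
    (hG' : ∀ i k, ∑ j, pderiv j (P i) * G j k = if i = k then 1 else 0)
    {n : ℤ} {a : MvPolynomial σ K} (ha : eulerField P G w a = (n : K) • a) (i : σ) :
    eulerField P G w (dualField G i a) = ((n - w i : ℤ) : K) • dualField G i a := by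
  have h : ⁅eulerField P G w, dualField G i⁆ = (-(w i : K)) • dualField G i :=
    derivation_eq_of_eq_on hG fun k => by
      rw [PolyForm.commutator_eq, eulerField_apply_self hG', Derivation.smul_apply,
        Derivation.map_smul, dualField_apply_self hG']
      split_ifs with hk
      · subst hk; simp
      · simp
  have h2 := congrArg (fun D : Derivation K (MvPolynomial σ K) (MvPolynomial σ K) => D a) h
  simp only [PolyForm.commutator_eq, Derivation.smul_apply, ha, Derivation.map_smul] at h2
  rw [sub_eq_iff_eq_add.1 h2, Int.cast_sub, sub_smul, neg_smul]
  abel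

variable [CharZero K]

lemma eq_zero_of_eulerField_eq_neg
    (hG : ∀ k j, ∑ i, G k i * pderiv j (P i) = if j = k then 1 else 0)
    (hG' : ∀ i k, ∑ j, pderiv j (P i) * G j k = if i = k then 1 else 0)
    (hw : ∀ i, 0 < w i) (hI : Ideal.span (Set.range P) ≠ ⊤) {n : ℤ} (hn : n < 0)
    {a : MvPolynomial σ K} (ha : eulerField P G w a = (n : K) • a) : a = 0 := by
  have key : ∀ (k : ℕ) (n : ℤ), n < 0 → ∀ a : MvPolynomial σ K,
      eulerField P G w a = (n : K) • a → a ∈ Ideal.span (Set.range P) ^ k := by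
    intro k
    induction k with
    | zero => simp
    | succ k ih =>
      intro n hn a ha
      have hn' : (n : K) ≠ 0 := by exact_mod_cast hn.ne
      rw [← inv_smul_smul₀ hn' a, ← ha, eulerField_apply, pow_succ']
      refine Submodule.smul_of_tower_mem _ _ (Submodule.sum_mem _ fun i _ =>
        Submodule.smul_of_tower_mem _ _ (Ideal.mul_mem_mul
          (Ideal.subset_span (Set.mem_range_self i))
          (ih (n - w i) (by have := hw i; omega) _ (eulerField_dualField hG hG' ha i))))
  have h : a ∈ ⨅ k : ℕ, Ideal.span (Set.range P) ^ k :=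
    (Submodule.mem_iInf _).2 fun k => key k n hn a ha
  rwa [Ideal.iInf_pow_eq_bot_of_isDomain _ hI] at h

lemma mem_range_aeval_of_pderiv_eq_zero {a : MvPolynomial σ K} (ha : ∀ j, pderiv j a = 0) :
    a ∈ (aeval P : MvPolynomial σ K →ₐ[K] MvPolynomial σ K).range := by
  have h : a = C (coeff 0 a) := by
    ext m
    rw [coeff_C]
    split_ifs with hm
    · rw [hm]
    · have := PolyForm.coeff_sum_X_mul_pderiv a m
      simp only [ha, mul_zero, Finset.sum_const_zero, coeff_zero] at this
      refine (mul_eq_zero.1 this.symm).resolve_left ?_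
      rw [Nat.cast_eq_zero, Finsupp.degree_eq_zero_iff]
      exact Ne.symm hm
  rw [h]
  exact ⟨C (coeff 0 a), by simp [← algebraMap_eq]⟩

lemma mem_range_aeval_of_eulerField_eq
    (hG : ∀ k j, ∑ i, G k i * pderiv j (P i) = if j = k then 1 else 0)
    (hG' : ∀ i k, ∑ j, pderiv j (P i) * G j k = if i = k then 1 else 0)
    (hw : ∀ i, 0 < w i) (hI : Ideal.span (Set.range P) ≠ ⊤) (n : ℤ)
    (a : MvPolynomial σ K) (ha : eulerField P G w a = (n : K) • a) :
    a ∈ (aeval P : MvPolynomial σ K →ₐ[K] MvPolynomial σ K).range := by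
  obtain ⟨m, hm⟩ : ∃ m : ℕ, n < m := ⟨n.toNat + 1, by omega⟩
  induction m generalizing n a with
  | zero => exact eq_zero_of_eulerField_eq_neg hG hG' hw hI (by simpa using hm) ha ▸ zero_mem _
  | succ m ih =>
    have hδ := eulerField_dualField hG hG' ha
    rcases lt_trichotomy n 0 with hn | rfl | hn
    · exact eq_zero_of_eulerField_eq_neg hG hG' hw hI hn ha ▸ zero_mem _
    · refine mem_range_aeval_of_pderiv_eq_zero fun j => ?_
      rw [pderiv_eq_sum_dualField hG hG']
      refine Finset.sum_eq_zero fun i _ => ?_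
      rw [eq_zero_of_eulerField_eq_neg hG hG' hw hI (by have := hw i; omega) (hδ i), mul_zero]
    · have hn' : (n : K) ≠ 0 := by exact_mod_cast hn.ne'
      rw [← inv_smul_smul₀ hn' a, ← ha, eulerField_apply]
      refine Subalgebra.smul_mem _ (Subalgebra.sum_mem _ fun i _ => Subalgebra.smul_mem _
        (Subalgebra.mul_mem _ ((AlgHom.mem_range _).2 ⟨X i, aeval_X P i⟩)
          (ih (n - w i) _ (hδ i) (by have := hw i; omega))) _) _

end DualFrame

lemma exists_jacobian_inverse {σ K : Type*} [Field K] [IsAlgClosed K] [Fintype σ] [DecidableEq σ]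
    (P : σ → MvPolynomial σ K)
    (hP : ∀ x : σ → K, IsUnit (Matrix.of fun i j : σ => eval x (pderiv j (P i)))) :
    ∃ G : σ → σ → MvPolynomial σ K,
      (∀ k j, ∑ i, G k i * pderiv j (P i) = if j = k then 1 else 0) ∧
      ∀ i k, ∑ j, pderiv j (P i) * G j k = if i = k then 1 else 0 := by
  let J : Matrix σ σ (MvPolynomial σ K) := Matrix.of fun i j => pderiv j (P i)
  have hJ : IsUnit J.det := isUnit_of_forall_eval_ne_zero _ fun x => by
    rw [RingHom.map_det]
    exact ((Matrix.isUnit_iff_isUnit_det _).1 (hP x)).ne_zero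
  refine ⟨fun k i => (J⁻¹ : Matrix σ σ _) k i, fun k j => ?_, fun i k => ?_⟩
  · simpa [Matrix.mul_apply, Matrix.one_apply, J, eq_comm] using
      congrFun (congrFun (Matrix.nonsing_inv_mul J hJ) k) j
  · simpa [Matrix.mul_apply, Matrix.one_apply, J] using
      congrFun (congrFun (Matrix.mul_nonsing_inv J hJ) i) k

theorem bijective_of_equivariant_etale (r : ℕ) (hr : 1 ≤ r)
    (f : (Fin r → ℂ) → (Fin r → ℂ))
    (P : Fin r → MvPolynomial (Fin r) ℂ)
    (hfP : ∀ (x : Fin r → ℂ) (i : Fin r), f x i = eval x (P i))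
    (α : ℂˣ → (Fin r → ℂ) → (Fin r → ℂ))
    (hα1 : α 1 = id)
    (hαmul : ∀ s t : ℂˣ, α (s * t) = α s ∘ α t)
    (N : ℕ) (Q : Fin r → MvPolynomial (Fin (r + 1)) ℂ)
    (hQ : ∀ (t : ℂˣ) (x : Fin r → ℂ) (i : Fin r),
      (t : ℂ) ^ N * α t x i = eval (Fin.cons (t : ℂ) x) (Q i))
    (w : Fin r → ℤ) (hw : ∀ i, 0 < w i)
    (hequiv : ∀ (t : ℂˣ) (x : Fin r → ℂ) (i : Fin r),
      f (α t x) i = (t : ℂ) ^ (-(w i)) * f x i)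
    (hjac : ∀ x : Fin r → ℂ,
      IsUnit (Matrix.of fun i j : Fin r => eval x (pderiv j (P i)))) :
    Function.Bijective f := by
  simp only [hfP] at hequiv
  obtain ⟨G, hG, hG'⟩ := exists_jacobian_inverse P hjac
  have hspan := mem_span_eigenvector hα1 hαmul hQ P w hw hequiv G hG
  have hI : Ideal.span (Set.range P) ≠ ⊤ := fun hI => by
    rw [Ideal.eq_top_iff_one, Ideal.mem_span_range_iff_exists_fun] at hI
    obtain ⟨b, hb⟩ := hI
    refine PolyForm.sum_mul_ne_one (fun j => ∑ i, (w i : ℂ) • (G j i * P i))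
      (fun a => Submodule.span_mono ?_ (hspan a)) P (fun i => (w i : ℂ))
      (fun i => ?_) G hG (fun j => ∑ k, (w k : ℂ)⁻¹ • (b k * pderiv j (P k))) ?_
    · rintro a ⟨n, hn⟩
      exact ⟨n, hn⟩
    · rw [← eulerField_apply_eq_sum_pderiv, eulerField_apply_self hG']
    · have hwk : ∀ k, (w k : ℂ) ≠ 0 := fun k => by exact_mod_cast (hw k).ne'
      rw [← hb]
      calc ∑ j, (∑ i, (w i : ℂ) • (G j i * P i)) * ∑ k, (w k : ℂ)⁻¹ • (b k * pderiv j (P k))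
          = ∑ k, (w k : ℂ)⁻¹ • (b k * eulerField P G w (P k)) := by
            simp only [eulerField_apply_eq_sum_pderiv, Finset.mul_sum (_ : Finset (Fin r)),
              Finset.smul_sum]
            rw [Finset.sum_comm]
            refine Finset.sum_congr rfl fun k _ => Finset.sum_congr rfl fun j _ => ?_
            rw [mul_smul_comm, mul_left_comm]
        _ = ∑ k, b k * P k := Finset.sum_congr rfl fun k _ => by
            rw [eulerField_apply_self hG', mul_smul_comm, inv_smul_smul₀ (hwk k)]
  have hrange : ∀ a, a ∈ (aeval P : MvPolynomial (Fin r) ℂ →ₐ[ℂ] MvPolynomial (Fin r) ℂ).range :=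
    fun a => by
      refine (Submodule.span_le (p := Subalgebra.toSubmodule (aeval P).range)).2 ?_ (hspan a)
      rintro a ⟨n, hn⟩
      rw [← eulerField_apply_eq_sum_pderiv] at hn
      exact mem_range_aeval_of_eulerField_eq hG hG' hw hI n a hn
  have hinj : Function.Injective f := fun x y hxy => by
    funext j
    obtain ⟨q, hq⟩ := hrange (X j)
    have key : ∀ x, x j = eval (f x) q := fun x => by
      have h := congrArg (eval x) hq
      rw [eval_X] at h
      rw [← h, funext (hfP x), AlgHom.toRingHom_eq_coe, RingHom.coe_coe, aeval_def,
        eval_eval₂, eval]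
      congr 1
      ext
      simp
    rw [key x, key y, hxy]
  obtain rfl : f = fun x i => eval x (P i) := funext fun x => funext (hfP x)
  exact ⟨hinj, ax_grothendieck_univ P hinj⟩
end

section
/- For all positive integers k and ℓ, the following are equivalent: (i) there exist integers a and b with k(2k−1) + 2ak = ℓ(2ℓ−1) + 2bℓ (equivalently, 2k(2k−1)/2 + a·2k = 2ℓ(2ℓ−1)/2 + b·2ℓ); (ii) k and ℓ are divisible by exactly the same power of 2, i.e. padicValNat 2 k = padicValNat 2 ℓ. -/
/-- If `k * u = l * v` with `u` and `v` odd integers, then `k` and `l` have the same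
`2`-adic valuation. -/
theorem padicValNat_two_eq_of_mul_odd_eq {k l : ℕ} (hk : k ≠ 0) (hl : l ≠ 0) {u v : ℤ}
    (hu : Odd u) (hv : Odd v) (h : (k : ℤ) * u = l * v) :
    padicValNat 2 k = padicValNat 2 l := by
  have h_abs : k * u.natAbs = l * v.natAbs := by
    simpa [Int.natAbs_mul] using congrArg Int.natAbs h
  have hu' : Odd u.natAbs := Int.natAbs_odd.2 hu
  have hv' : Odd v.natAbs := Int.natAbs_odd.2 hv
  have h_val := congrArg (padicValNat 2) h_abs
  rwa [padicValNat.mul hk hu'.pos.ne', padicValNat.mul hl hv'.pos.ne',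
    padicValNat.eq_zero_of_not_dvd hu'.not_two_dvd_nat,
    padicValNat.eq_zero_of_not_dvd hv'.not_two_dvd_nat, add_zero, add_zero] at h_val

/-- A nonzero natural number is the product of its `2`-part and an odd number. -/
theorem exists_eq_two_pow_padicValNat_mul_odd {n : ℕ} (hn : n ≠ 0) :
    ∃ m, Odd m ∧ n = 2 ^ padicValNat 2 n * m := by
  obtain ⟨m, hm⟩ := pow_padicValNat_dvd (p := 2) (n := n)
  refine ⟨m, ?_, hm⟩
  by_contra h_even
  obtain ⟨c, rfl⟩ := (Nat.not_odd_iff_even.1 h_even).two_dvd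
  exact pow_succ_padicValNat_not_dvd hn ⟨c, by rw [pow_succ, mul_assoc]; exact hm⟩

/-- For positive integers `k`, `ℓ`, there exist integers `a`, `b` with
`k(2k−1) + 2ak = ℓ(2ℓ−1) + 2bℓ` if and only if `k` and `ℓ` are divisible by exactly
the same power of `2`. -/
theorem twist_SL_iff (k l : ℕ) (hk : 0 < k) (hl : 0 < l) :
    (∃ a b : ℤ,
        (k : ℤ) * (2 * (k : ℤ) - 1) + 2 * a * (k : ℤ)
          = (l : ℤ) * (2 * (l : ℤ) - 1) + 2 * b * (l : ℤ))
      ↔ padicValNat 2 k = padicValNat 2 l := by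
  constructor
  · rintro ⟨a, b, h⟩
    refine padicValNat_two_eq_of_mul_odd_eq hk.ne' hl.ne'
      (u := 2 * (k + a - 1) + 1) (v := 2 * (l + b - 1) + 1) ⟨_, rfl⟩ ⟨_, rfl⟩ ?_
    linear_combination h
  · intro h
    obtain ⟨m, ⟨i, rfl⟩, hm⟩ := exists_eq_two_pow_padicValNat_mul_odd hk.ne'
    obtain ⟨n, ⟨j, rfl⟩, hn⟩ := exists_eq_two_pow_padicValNat_mul_odd hl.ne'
    have h_cross : (k : ℤ) * (2 * j + 1) = l * (2 * i + 1) := by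
      have h_nat : k * (2 * j + 1) = l * (2 * i + 1) :=
        calc k * (2 * j + 1) = 2 ^ padicValNat 2 k * (2 * i + 1) * (2 * j + 1) := by rw [← hm]
          _ = 2 ^ padicValNat 2 l * (2 * j + 1) * (2 * i + 1) := by rw [h]; ring
          _ = l * (2 * i + 1) := by rw [← hn]
      exact_mod_cast h_nat
    refine ⟨j + 1 - k, i + 1 - l, ?_⟩
    linear_combination h_cross
end
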